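/- Let n ∈ ℕ and let F : Δ_n(OXYZ) → ℝ be a polarized function on the tetrahedral grid Δ_n(OXYZ). Assume the restriction of F to the ground (face z = 0) is discrete concave, and the restriction of F to the front wall (face y = 0) is VS-concave with vertical direction e₃, i.e. strip-concave along e₃ (the families R(e₁) and R(e₁−e₃) hold on the front wall). Then the restriction of F to the shadow wall (face x = 0) is discrete concave. -/

import Mathlib

/-- Points of the three-dimensional lattice. -/
abbrev V3 : Type := ℤ × ℤ × ℤ

def e1 : V3 := (1, 0, 0)
def e2 : V3 := (0, 1, 0)
def e3 : V3 := (0, 0, 1)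

/-- The unimodular set `D = {e₁, e₂, e₃, e₁−e₂, e₁−e₃, e₂−e₃}`. -/
def Dset : Set V3 := {e1, e2, e3, e1 - e2, e1 - e3, e2 - e3}

/-- The set `±D = D ∪ (−D)`. -/
def pmD : Set V3 := {v | v ∈ Dset ∨ -v ∈ Dset}

/-- `F` is polarized on `S`: for every primitive octahedron contained in `S`, the sum of the
values at the ends of the main diagonal (direction `(−1,1,1)`) equals the maximum of the sums
at the ends of the two other diagonals. -/
def IsPolarizedOn (S : Set V3) (F : V3 → ℝ) : Prop :=
  ∀ p : V3, p ∈ S → p + (-1, 1, 1) ∈ S → p + (0, 0, 1) ∈ S → p + (-1, 1, 0) ∈ S →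
    p + (0, 1, 0) ∈ S → p + (-1, 0, 1) ∈ S →
    F p + F (p + (-1, 1, 1)) =
      max (F (p + (0, 0, 1)) + F (p + (-1, 1, 0))) (F (p + (0, 1, 0)) + F (p + (-1, 0, 1)))

/-- `(q, q+a, q+b, q+a+b)` is a primitive rhombus: `a, b ∈ ±D`, `a ≠ ±b`, and one of the
diagonal directions `a+b`, `a−b` lies in `±D` (that diagonal is the short one). -/
def IsPrimRhombus (a b : V3) : Prop :=
  a ∈ pmD ∧ b ∈ pmD ∧ a ≠ b ∧ a ≠ -b ∧ (a + b ∈ pmD ∨ a - b ∈ pmD)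

/-- The rhombus inequalities associated to the primitive rhombus `(q, q+a, q+b, q+a+b)`:
the sum at the short diagonal is at least the sum at the long diagonal. -/
def RhombusIneq (F : V3 → ℝ) (q a b : V3) : Prop :=
  (a + b ∈ pmD → F q + F (q + a + b) ≥ F (q + a) + F (q + b)) ∧
  (a - b ∈ pmD → F (q + a) + F (q + b) ≥ F q + F (q + a + b))

/-- All rhombus inequalities for primitive rhombi whose four points lie in `S` hold. -/
def DiscreteConcaveOn (S : Set V3) (F : V3 → ℝ) : Prop :=
  ∀ q a b : V3, IsPrimRhombus a b → q ∈ S → q + a ∈ S → q + b ∈ S → q + a + b ∈ S →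
    RhombusIneq F q a b

/-- `F` is polarized discrete concave on `S`. -/
def PDCOn (S : Set V3) (F : V3 → ℝ) : Prop :=
  IsPolarizedOn S F ∧ DiscreteConcaveOn S F

/-- The tetrahedral grid `Δ_n(OXYZ)`. -/
def Tet (n : ℕ) : Set V3 :=
  {v | 0 ≤ v.1 ∧ 0 ≤ v.2.1 ∧ 0 ≤ v.2.2 ∧ v.1 + v.2.1 + v.2.2 ≤ (n : ℤ)}

/-- The ground face `z = 0` of `Δ_n(OXYZ)`. -/
def ground (n : ℕ) : Set V3 := {v | v ∈ Tet n ∧ v.2.2 = 0}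

/-- The front wall `y = 0` of `Δ_n(OXYZ)`. -/
def frontWall (n : ℕ) : Set V3 := {v | v ∈ Tet n ∧ v.2.1 = 0}

/-- The shadow wall `x = 0` of `Δ_n(OXYZ)`. -/
def shadowWall (n : ℕ) : Set V3 := {v | v ∈ Tet n ∧ v.1 = 0}

/-- The slope wall `x + y + z = n` of `Δ_n(OXYZ)`. -/
def slopeWall (n : ℕ) : Set V3 := {v | v ∈ Tet n ∧ v.1 + v.2.1 + v.2.2 = (n : ℤ)}

/-- The family `R(d)` of rhombus inequalities on `S` for rhombi whose short diagonal has
direction `±d`. -/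
def FaceR (S : Set V3) (F : V3 → ℝ) (d : V3) : Prop :=
  ∀ q a b : V3, IsPrimRhombus a b → q ∈ S → q + a ∈ S → q + b ∈ S → q + a + b ∈ S →
    ((a + b = d ∨ a + b = -d) → F q + F (q + a + b) ≥ F (q + a) + F (q + b)) ∧
    ((a - b = d ∨ a - b = -d) → F (q + a) + F (q + b) ≥ F q + F (q + a + b))

/-- The octahedron recurrence on the tetrahedral grid of size `n`, in coordinates: the octahedron
is the middle part of the unit cube with least corner `(x, y, z)`. -/
def OctahedronRec (n : ℕ) (G : ℤ → ℤ → ℤ → ℝ) : Prop :=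
  ∀ x y z : ℤ, 0 ≤ x → 0 ≤ y → 0 ≤ z → x + y + z + 2 ≤ n →
    G (x + 1) y z + G x (y + 1) (z + 1) =
      max (G (x + 1) y (z + 1) + G x (y + 1) z) (G (x + 1) (y + 1) z + G x y (z + 1))

theorem IsPolarizedOn.octahedronRec {n : ℕ} {F : V3 → ℝ} (h : IsPolarizedOn (Tet n) F) :
    OctahedronRec n (fun x y z => F (x, y, z)) := by
  intro x y z hx hy hz hn
  have := h (x + 1, y, z)
  simp only [Tet, Set.mem_ofPred_eq, Prod.mk_add_mk, add_zero, add_neg_cancel_right] at this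
  exact this (by omega) (by omega) (by omega) (by omega) (by omega) (by omega)

namespace OctahedronRec

variable {n : ℕ} {G : ℤ → ℤ → ℤ → ℝ}

theorem swap (h : OctahedronRec n G) : OctahedronRec n (fun x y z => G x z y) := by
  intro x y z hx hy hz hn
  have := h x z y hx hz hy (by omega)
  rw [max_comm] at this
  exact this

theorem le_left (h : OctahedronRec n G) {x y z : ℤ} (hx : 0 ≤ x) (hy : 0 ≤ y) (hz : 0 ≤ z)
    (hn : x + y + z + 2 ≤ n) :
    G (x + 1) y (z + 1) + G x (y + 1) z ≤ G (x + 1) y z + G x (y + 1) (z + 1) :=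
  (le_max_left _ _).trans_eq (h x y z hx hy hz hn).symm

theorem le_right (h : OctahedronRec n G) {x y z : ℤ} (hx : 0 ≤ x) (hy : 0 ≤ y) (hz : 0 ≤ z)
    (hn : x + y + z + 2 ≤ n) :
    G (x + 1) (y + 1) z + G x y (z + 1) ≤ G (x + 1) y z + G x (y + 1) (z + 1) :=
  (le_max_right _ _).trans_eq (h x y z hx hy hz hn).symm

/-- The family `R(e₁)` propagates from the front wall to all slices parallel to it. -/
theorem rhombus_e1 (h : OctahedronRec n G)
    (h₀ : ∀ x z : ℤ, 0 ≤ x → 0 ≤ z → x + z + 2 ≤ n →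
      G x 0 (z + 1 + 1) + G (x + 1) 0 z ≤ G x 0 (z + 1) + G (x + 1) 0 (z + 1))
    {y : ℤ} (hy : 0 ≤ y) : ∀ x z : ℤ, 0 ≤ x → 0 ≤ z → x + y + z + 2 ≤ n →
      G x y (z + 1 + 1) + G (x + 1) y z ≤ G x y (z + 1) + G (x + 1) y (z + 1) := by
  induction y, hy using Int.leInduction with
  | base => exact fun x z hx hz hn => h₀ x z hx hz (by omega)
  | succ y hy ih =>
    intro x z hx hz hn
    have hoct := h x y (z + 1) hx hy (by omega) (by omega)
    rcases max_choice (G (x + 1) y (z + 1 + 1) + G x (y + 1) (z + 1))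
      (G (x + 1) (y + 1) (z + 1) + G x y (z + 1 + 1)) with hmax | hmax
    · have h₁ := h.le_left (x := x + 1) (by omega) hy hz (by omega)
      have h₂ := ih (x + 1) z (by omega) hz (by omega)
      linarith
    · have h₁ := h.le_right hx hy hz (by omega)
      have h₂ := ih x z hx hz (by omega)
      linarith

/-- In slices parallel to the shadow wall, `R(e₂)` follows from `R(e₁)` on the front wall. -/
theorem rhombus_e2 (h : OctahedronRec n G)
    (h₀ : ∀ x z : ℤ, 0 ≤ x → 0 ≤ z → x + z + 2 ≤ n →
      G x 0 (z + 1 + 1) + G (x + 1) 0 z ≤ G x 0 (z + 1) + G (x + 1) 0 (z + 1))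
    {x y z : ℤ} (hx : 0 ≤ x) (hy : 0 ≤ y) (hz : 0 ≤ z) (hn : x + y + z + 2 ≤ n) :
    G x y (z + 1 + 1) + G x (y + 1) z ≤ G x y (z + 1) + G x (y + 1) (z + 1) := by
  have h₁ := h.le_left hx hy hz hn
  have h₂ := h.rhombus_e1 h₀ hy x z hx hz hn
  linarith

/-- The rhombus inequality for the short diagonal `e₂ - e₃`, from those for `e₁ - e₃` and
`e₁ - e₂`. -/
theorem rhombus_e2_sub_e3_of (h : OctahedronRec n G) {x y z : ℤ} (hx : 0 ≤ x) (hy : 0 ≤ y)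
    (hz : 0 ≤ z) (hn : x + y + z + 2 ≤ n)
    (h₁ : G x y z + G (x + 1) y (z + 1) ≤ G (x + 1) y z + G x y (z + 1))
    (h₂ : G x y z + G (x + 1) (y + 1) z ≤ G (x + 1) y z + G x (y + 1) z) :
    G x y z + G x (y + 1) (z + 1) ≤ G x (y + 1) z + G x y (z + 1) := by
  have hoct := h x y z hx hy hz hn
  rcases max_choice (G (x + 1) y (z + 1) + G x (y + 1) z)
    (G (x + 1) (y + 1) z + G x y (z + 1)) with hmax | hmax <;> linarith

/-- In slices parallel to the shadow wall, `R(e₂ - e₃)` follows from `R(e₁ - e₃)` on the front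
wall and `R(e₁ - e₂)` on the ground. -/
theorem rhombus_e2_sub_e3 (h : OctahedronRec n G)
    (hfront : ∀ x z : ℤ, 0 ≤ x → 0 ≤ z → x + z + 2 ≤ n →
      G x 0 z + G (x + 1) 0 (z + 1) ≤ G (x + 1) 0 z + G x 0 (z + 1))
    (hground : ∀ x y : ℤ, 0 ≤ x → 0 ≤ y → x + y + 2 ≤ n →
      G x y 0 + G (x + 1) (y + 1) 0 ≤ G (x + 1) y 0 + G x (y + 1) 0)
    {x y z : ℤ} (hx : 0 ≤ x) (hy : 0 ≤ y) (hz : 0 ≤ z) (hn : x + y + z + 2 ≤ n) :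
    G x y z + G x (y + 1) (z + 1) ≤ G x (y + 1) z + G x y (z + 1) := by
  refine h.rhombus_e2_sub_e3_of hx hy hz hn ?_ ?_
  · rcases hy.eq_or_lt with rfl | hy'
    · exact hfront x z hx hz (by omega)
    · obtain ⟨y, rfl⟩ : ∃ t, y = t + 1 := ⟨y - 1, by omega⟩
      have h₁ := h.le_left (x := x) (y := y) (z := z) hx (by omega) hz (by omega)
      have h₂ := rhombus_e2_sub_e3 h hfront hground (x := x + 1) (y := y) (z := z)
        (by omega) (by omega) hz (by omega)
      linarith
  · rcases hz.eq_or_lt with rfl | hz'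
    · exact hground x y hx hy (by omega)
    · obtain ⟨z, rfl⟩ : ∃ t, z = t + 1 := ⟨z - 1, by omega⟩
      have h₁ := h.le_right (x := x) (y := y) (z := z) hx hy (by omega) (by omega)
      have h₂ := rhombus_e2_sub_e3 h hfront hground (x := x + 1) (y := y) (z := z)
        (by omega) hy (by omega) (by omega)
      linarith
termination_by (y + z).toNat

end OctahedronRec

theorem mem_pmD_iff {a b c : ℤ} : ((a, b, c) : V3) ∈ pmD ↔
    (a = 1 ∧ b = 0 ∧ c = 0) ∨ (a = 0 ∧ b = 1 ∧ c = 0) ∨ (a = 0 ∧ b = 0 ∧ c = 1) ∨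
    (a = 1 ∧ b = -1 ∧ c = 0) ∨ (a = 1 ∧ b = 0 ∧ c = -1) ∨ (a = 0 ∧ b = 1 ∧ c = -1) ∨
    (a = -1 ∧ b = 0 ∧ c = 0) ∨ (a = 0 ∧ b = -1 ∧ c = 0) ∨ (a = 0 ∧ b = 0 ∧ c = -1) ∨
    (a = -1 ∧ b = 1 ∧ c = 0) ∨ (a = -1 ∧ b = 0 ∧ c = 1) ∨ (a = 0 ∧ b = -1 ∧ c = 1) := by
  simp [pmD, Dset, e1, e2, e3, neg_eq_iff_eq_neg, or_assoc]

theorem zero_mem_pmD_iff {b c : ℤ} : ((0, b, c) : V3) ∈ pmD ↔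
    (b = 1 ∧ c = 0) ∨ (b = 0 ∧ c = 1) ∨ (b = 1 ∧ c = -1) ∨
    (b = -1 ∧ c = 0) ∨ (b = 0 ∧ c = -1) ∨ (b = -1 ∧ c = 1) := by
  simp [mem_pmD_iff]

theorem neg_mem_pmD {a : V3} (ha : a ∈ pmD) : -a ∈ pmD := by
  simpa [pmD, or_comm] using ha

/-- On the shadow wall, discrete concavity amounts to three families of inequalities. -/
theorem discreteConcaveOn_shadowWall {n : ℕ} {F : V3 → ℝ}
    (h2 : ∀ y z : ℤ, 0 ≤ y → 0 ≤ z → y + z + 2 ≤ n →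
      F (0, y, z + 1 + 1) + F (0, y + 1, z) ≤ F (0, y, z + 1) + F (0, y + 1, z + 1))
    (h3 : ∀ y z : ℤ, 0 ≤ y → 0 ≤ z → y + z + 2 ≤ n →
      F (0, y + 1 + 1, z) + F (0, y, z + 1) ≤ F (0, y + 1, z) + F (0, y + 1, z + 1))
    (h23 : ∀ y z : ℤ, 0 ≤ y → 0 ≤ z → y + z + 2 ≤ n →
      F (0, y, z) + F (0, y + 1, z + 1) ≤ F (0, y + 1, z) + F (0, y, z + 1)) :
    DiscreteConcaveOn (shadowWall n) F := by
  have key : ∀ q a b : V3, a ∈ pmD → b ∈ pmD → a + b ∈ pmD → q ∈ shadowWall n →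
      q + a ∈ shadowWall n → q + b ∈ shadowWall n → q + a + b ∈ shadowWall n →
      F (q + a) + F (q + b) ≤ F q + F (q + a + b) := by
    rintro ⟨x, y, z⟩ ⟨a₁, a₂, a₃⟩ ⟨b₁, b₂, b₃⟩ ha hb hab hq hqa hqb hqab
    simp only [Prod.mk_add_mk, shadowWall, Tet, Set.mem_ofPred_eq] at hab hq hqa hqb hqab ⊢
    obtain rfl : x = 0 := by omega
    obtain rfl : a₁ = 0 := by omega
    obtain rfl : b₁ = 0 := by omega
    rw [add_zero, zero_mem_pmD_iff] at hab
    rw [zero_mem_pmD_iff] at ha hb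
    simp only [add_zero] at hq hqa hqb hqab ⊢
    rcases ha with ⟨rfl, rfl⟩ | ⟨rfl, rfl⟩ | ⟨rfl, rfl⟩ | ⟨rfl, rfl⟩ | ⟨rfl, rfl⟩ | ⟨rfl, rfl⟩ <;>
      rcases hb with ⟨rfl, rfl⟩ | ⟨rfl, rfl⟩ | ⟨rfl, rfl⟩ | ⟨rfl, rfl⟩ | ⟨rfl, rfl⟩ | ⟨rfl, rfl⟩ <;>
      norm_num at hab
    · have := h23 y (z - 1) (by omega) (by omega) (by omega)
      ring_nf at this ⊢
      linarith
    · have := h3 (y - 1) z (by omega) (by omega) (by omega)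
      ring_nf at this ⊢
      linarith
    · have := h2 y (z - 1) (by omega) (by omega) (by omega)
      ring_nf at this ⊢
      linarith
    · have := h23 (y - 1) z (by omega) (by omega) (by omega)
      ring_nf at this ⊢
      linarith
    · have := h2 y (z - 1) (by omega) (by omega) (by omega)
      ring_nf at this ⊢
      linarith
    · have := h3 (y - 1) (z - 1) (by omega) (by omega) (by omega)
      ring_nf at this ⊢
      linarith
    · have := h23 (y - 1) z (by omega) (by omega) (by omega)
      ring_nf at this ⊢
      linarith
    · have := h3 (y - 1) (z - 1) (by omega) (by omega) (by omega)
      ring_nf at this ⊢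
      linarith
    · have := h23 y (z - 1) (by omega) (by omega) (by omega)
      ring_nf at this ⊢
      linarith
    · have := h2 (y - 1) (z - 1) (by omega) (by omega) (by omega)
      ring_nf at this ⊢
      linarith
    · have := h3 (y - 1) z (by omega) (by omega) (by omega)
      ring_nf at this ⊢
      linarith
    · have := h2 (y - 1) (z - 1) (by omega) (by omega) (by omega)
      ring_nf at this ⊢
      linarith
  rintro q a b ⟨ha, hb, -, -, -⟩ hq hqa hqb hqab
  refine ⟨fun hab => key q a b ha hb hab hq hqa hqb hqab, fun hab => ?_⟩
  have := key (q + b) (-b) a (neg_mem_pmD hb) ha (by rwa [neg_add_eq_sub]) hqb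
    (by rwa [add_neg_cancel_right]) (by rwa [add_right_comm]) (by rwa [add_neg_cancel_right])
  rw [add_neg_cancel_right, add_right_comm] at this
  linarith

/-- if a polarized function on `Δ_n(OXYZ)` is discrete concave on the ground and
VS-concave on the front wall (strip-concave along `e₃`: `R(e₁)` and `R(e₁−e₃)` hold), then its
restriction to the shadow wall is discrete concave. -/
theorem tet_shadow_discrete_concave (n : ℕ) (F : V3 → ℝ)
    (hpol : IsPolarizedOn (Tet n) F)
    (hground : DiscreteConcaveOn (ground n) F)
    (hfront₁ : FaceR (frontWall n) F e1)
    (hfront₂ : FaceR (frontWall n) F (e1 - e3)) :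
    DiscreteConcaveOn (shadowWall n) F := by
  have hoct := hpol.octahedronRec
  refine discreteConcaveOn_shadowWall (fun y z hy hz hn => ?_) (fun y z hy hz hn => ?_)
    (fun y z hy hz hn => ?_)
  · refine hoct.rhombus_e2 (fun x z hx hz hn => ?_) le_rfl hy hz (by omega)
    have := (hfront₁ (x, 0, z + 1) (0, 0, 1) (1, 0, -1) ?_ ?_ ?_ ?_ ?_).1 ?_ <;>
      simp_all [IsPrimRhombus, mem_pmD_iff, frontWall, Tet, e1] <;> grind
  · refine hoct.swap.rhombus_e2 (fun x y hx hy hn => ?_) le_rfl hz hy (by omega)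
    have := (hground (x, y + 1, 0) (0, 1, 0) (1, -1, 0) ?_ ?_ ?_ ?_ ?_).1 ?_ <;>
      simp_all [IsPrimRhombus, mem_pmD_iff, ground, Tet] <;> grind
  · refine hoct.rhombus_e2_sub_e3 (fun x z hx hz hn => ?_) (fun x y hx hy hn => ?_)
      le_rfl hy hz (by omega)
    · have := (hfront₂ (x, 0, z) (1, 0, 0) (0, 0, 1) ?_ ?_ ?_ ?_ ?_).2 ?_ <;>
        simp_all [IsPrimRhombus, mem_pmD_iff, frontWall, Tet, e1, e3] <;> grind
    · have := (hground (x, y, 0) (1, 0, 0) (0, 1, 0) ?_ ?_ ?_ ?_ ?_).2 ?_ <;>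
        simp_all [IsPrimRhombus, mem_pmD_iff, ground, Tet] <;> grind
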